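/- Let n ≥ 2 and 0 < ε < 1. Consider n agents and m = n + 1 items with valuations v_{ij} = 1 if i = j and v_{ij} = ε otherwise (for i ∈ [n], j ∈ [n+1]). Then no partition of the items into n bundles is symEFX, but there exists a partition of the items into n bundles that is symEF1. -/

import Mathlib

/-- Additive value of agent `i` for bundle `A`. -/
def bundleVal {n m : ℕ} (v : Fin n → Fin m → ℝ) (i : Fin n) (A : Finset (Fin m)) : ℝ :=
  ∑ j ∈ A, v i j

/-- Value of agent `i`'s favorite item in `A` (0 if `A` is empty). -/
def maxVal {n m : ℕ} (v : Fin n → Fin m → ℝ) (i : Fin n) (A : Finset (Fin m)) : ℝ :=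
  if h : A.Nonempty then A.sup' h (v i) else 0

/-- Value of agent `i`'s least-valued item in `A` (0 if `A` is empty). -/
def minVal {n m : ℕ} (v : Fin n → Fin m → ℝ) (i : Fin n) (A : Finset (Fin m)) : ℝ :=
  if h : A.Nonempty then A.inf' h (v i) else 0

/-- `(A 1, …, A n)` is a partition of the items: every item is in exactly one bundle. -/
def IsPartition {n m : ℕ} (A : Fin n → Finset (Fin m)) : Prop :=
  ∀ j : Fin m, ∃! k : Fin n, j ∈ A k

/-- Symmetrically envy free up to one good. -/
def SymEF1 {n m : ℕ} (v : Fin n → Fin m → ℝ) (A : Fin n → Finset (Fin m)) : Prop :=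
  ∀ i k l : Fin n, bundleVal v i (A k) ≥ bundleVal v i (A l) - maxVal v i (A l)

/-- Symmetrically envy free up to any good. -/
def SymEFX {n m : ℕ} (v : Fin n → Fin m → ℝ) (A : Fin n → Finset (Fin m)) : Prop :=
  ∀ i k l : Fin n, bundleVal v i (A k) ≥ bundleVal v i (A l) - minVal v i (A l)

/-- `σ` is a ranking for agent `i`: `σ` lists the items from most to least favorite. -/
def IsRanking {n m : ℕ} (v : Fin n → Fin m → ℝ) (i : Fin n) (σ : Equiv.Perm (Fin m)) : Prop :=
  ∀ (j : ℕ) (h : j + 1 < m), v i (σ ⟨j + 1, h⟩) ≤ v i (σ ⟨j, Nat.lt_of_succ_lt h⟩)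

/-- The `t`-th indexed `n`-tuple (0-indexed `t`) for the ranking `σ`:
    the items ranked in positions `n*t, …, n*t + n - 1` (0-indexed, positions `< m`). -/
def nTuple {m : ℕ} (n : ℕ) (σ : Equiv.Perm (Fin m)) (t : ℕ) : Finset (Fin m) :=
  (Finset.univ.filter (fun p : Fin m => p.val / n = t)).image σ

/-- The `l`-th bundle (0-indexed `l`) of the round-robin allocation of the agent whose
    ranking is `σ`: the items ranked in positions congruent to `l` modulo `n`. -/
def rrBundle {m : ℕ} (n : ℕ) (σ : Equiv.Perm (Fin m)) (l : ℕ) : Finset (Fin m) :=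
  (Finset.univ.filter (fun p : Fin m => p.val % n = l)).image σ

/-- The partition `A` separates the indexed `n`-tuples induced by the ranking `σ`:
    no two distinct items of a common `n`-tuple lie in the same bundle. -/
def Separates {n m : ℕ} (σ : Equiv.Perm (Fin m)) (A : Fin n → Finset (Fin m)) : Prop :=
  ∀ (t : ℕ), ∀ j1 ∈ nTuple n σ t, ∀ j2 ∈ nTuple n σ t, j1 ≠ j2 →
    ∀ k : Fin n, j1 ∈ A k → j2 ∉ A k

/-- The item graph: vertices are the items, with an edge between two distinct items
    whenever they belong to a common indexed `n`-tuple of some agent. -/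
def itemGraph {m : ℕ} (n : ℕ) (σ : Fin n → Equiv.Perm (Fin m)) : SimpleGraph (Fin m) :=
  SimpleGraph.fromRel (fun j1 j2 => ∃ (i : Fin n) (t : ℕ),
    j1 ∈ nTuple n (σ i) t ∧ j2 ∈ nTuple n (σ i) t)

/-- The bundles of a partition of `m` items have `m` items in total. -/
lemma IsPartition.sum_card {n m : ℕ} {A : Fin n → Finset (Fin m)} (hA : IsPartition A) :
    ∑ k, (A k).card = m := by
  choose f hf hf_unique using hA
  have hA_eq (k : Fin n) : A k = Finset.univ.filter (fun j => f j = k) := by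
    ext j
    simp only [Finset.mem_filter, Finset.mem_univ, true_and]
    exact ⟨fun h => (hf_unique j k h).symm, fun h => h ▸ hf j⟩
  simp_rw [hA_eq]
  rw [← Finset.card_eq_sum_card_fiberwise (fun _ _ => Finset.mem_coe.2 (Finset.mem_univ _))]
  simp

lemma minVal_le {n m : ℕ} (v : Fin n → Fin m → ℝ) (i : Fin n) {A : Finset (Fin m)} {j : Fin m}
    (hj : j ∈ A) : minVal v i A ≤ v i j := by
  rw [minVal, dif_pos ⟨j, hj⟩]
  exact Finset.inf'_le _ hj

lemma le_maxVal {n m : ℕ} (v : Fin n → Fin m → ℝ) (i : Fin n) {A : Finset (Fin m)} {j : Fin m}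
    (hj : j ∈ A) : v i j ≤ maxVal v i A := by
  rw [maxVal, dif_pos ⟨j, hj⟩]
  exact Finset.le_sup' _ hj

/-- with `n` agents and `n + 1` items where `v i j = 1` if `i = j` and `ε`
otherwise (`0 < ε < 1`), no partition into `n` bundles is symEFX, yet a symEF1 partition
exists. -/
theorem statement14 (n : ℕ) (hn : 2 ≤ n) (ε : ℝ) (hε0 : 0 < ε) (hε1 : ε < 1) :
    (∀ A : Fin n → Finset (Fin (n + 1)), IsPartition A →
      ¬ SymEFX (fun (i : Fin n) (j : Fin (n + 1)) =>
          if j.val = i.val then (1 : ℝ) else ε) A) ∧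
    (∃ A : Fin n → Finset (Fin (n + 1)), IsPartition A ∧
      SymEF1 (fun (i : Fin n) (j : Fin (n + 1)) =>
          if j.val = i.val then (1 : ℝ) else ε) A) := by
  constructor
  · intro A hA hEFX
    have hsum := hA.sum_card
    obtain ⟨l, hl⟩ : ∃ l, 1 < (A l).card := by
      by_contra! h
      have := Finset.sum_le_card_nsmul Finset.univ (fun k => (A k).card) 1 (fun k _ => h k)
      simp at this
      omega
    obtain ⟨k, hk⟩ : ∃ k, (A k).card ≤ 1 := by
      by_contra! h
      have := Finset.card_nsmul_le_sum Finset.univ (fun k => (A k).card) 2 (fun k _ => h k)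
      simp at this
      omega
    obtain ⟨a, b, ha, hb, hab, han⟩ : ∃ a b, a ∈ A l ∧ b ∈ A l ∧ a ≠ b ∧ a.val < n := by
      obtain ⟨a, ha, b, hb, hab⟩ := Finset.one_lt_card.1 hl
      by_cases han : a.val < n
      · exact ⟨a, b, ha, hb, hab, han⟩
      · exact ⟨b, a, hb, ha, hab.symm, by have := Fin.val_ne_of_ne hab; omega⟩
    have hkl : k ≠ l := by rintro rfl; omega
    have hak : a ∉ A k := fun h => hkl ((hA a).unique h ha)
    have h := hEFX ⟨a.val, han⟩ k l
    have hmin := minVal_le (fun (i : Fin n) (j : Fin (n + 1)) =>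
      if j.val = i.val then (1 : ℝ) else ε) ⟨a.val, han⟩ hb
    have hba : b.val ≠ a.val := Fin.val_ne_of_ne hab.symm
    simp only [hba, if_false] at hmin
    have hlarge : 1 + ε ≤ bundleVal (fun (i : Fin n) (j : Fin (n + 1)) =>
        if j.val = i.val then (1 : ℝ) else ε) ⟨a.val, han⟩ (A l) := by
      calc 1 + ε = ∑ j ∈ ({a, b} : Finset (Fin (n + 1))),
            if j.val = a.val then (1 : ℝ) else ε := by
            rw [Finset.sum_pair hab]; simp [hba]
        _ ≤ _ := Finset.sum_le_sum_of_subset_of_nonneg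
            (by simp [Finset.insert_subset_iff, ha, hb])
            (fun j _ _ => by split_ifs <;> linarith)
    have hsmall : bundleVal (fun (i : Fin n) (j : Fin (n + 1)) =>
        if j.val = i.val then (1 : ℝ) else ε) ⟨a.val, han⟩ (A k) ≤ ε := by
      calc _ ≤ (A k).card • ε := Finset.sum_le_card_nsmul _ _ _ (fun j hj => by
              have : j.val ≠ a.val := fun e => hak (Fin.ext e ▸ hj)
              simp [this])
        _ ≤ 1 • ε := nsmul_le_nsmul_left hε0.le hk
        _ = ε := one_nsmul ε
    linarith
  · let f : Fin (n + 1) → Fin n := fun j =>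
      if h : j.val < n then ⟨j.val, h⟩ else ⟨0, by omega⟩
    have hf (k : Fin n) : f k.castSucc = k := by simp [f]
    refine ⟨fun k => Finset.univ.filter (fun j => f j = k), fun j => ?_, fun i k l => ?_⟩
    · exact ⟨f j, by simp, fun k hk => (Finset.mem_filter.1 hk).2.symm⟩
    have hval (j : Fin (n + 1)) : ε ≤ if j.val = i.val then (1 : ℝ) else ε := by
      split_ifs <;> linarith
    have hlower : ε ≤ bundleVal (fun (i : Fin n) (j : Fin (n + 1)) =>
        if j.val = i.val then (1 : ℝ) else ε) i (Finset.univ.filter (fun j => f j = k)) :=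
      (hval k.castSucc).trans (Finset.single_le_sum
        (f := fun j : Fin (n + 1) => if j.val = i.val then (1 : ℝ) else ε)
        (fun j _ => hε0.le.trans (hval j)) (by simp [hf]))
    have hmax := le_maxVal (fun (i : Fin n) (j : Fin (n + 1)) =>
      if j.val = i.val then (1 : ℝ) else ε) i
      (A := Finset.univ.filter (fun j => f j = l)) (j := l.castSucc) (by simp [hf])
    have hupper : bundleVal (fun (i : Fin n) (j : Fin (n + 1)) =>
        if j.val = i.val then (1 : ℝ) else ε) i (Finset.univ.filter (fun j => f j = l)) ≤
        (if l.castSucc.val = i.val then (1 : ℝ) else ε) + ε := by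
      have hne : l.castSucc ≠ Fin.last n := (Fin.castSucc_lt_last l).ne
      have hlast : (Fin.last n).val ≠ i.val := by have := i.isLt; simp; omega
      calc _ ≤ ∑ j ∈ ({l.castSucc, Fin.last n} : Finset (Fin (n + 1))),
            if j.val = i.val then (1 : ℝ) else ε :=
            Finset.sum_le_sum_of_subset_of_nonneg (fun j hj => by
              induction j using Fin.lastCases with
              | last => simp
              | cast j => simpa [hf] using hj) (fun j _ _ => hε0.le.trans (hval j))
        _ = _ := by rw [Finset.sum_pair hne, if_neg hlast]
    dsimp only at hmax ⊢
    linarith
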